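/- arXiv:1305.5884 — 5 statements merged into one kernel-verified Lean document; each statement's English description precedes it below -/
import Mathlib

section
/- Let n ≥ 1 and let q : Fin n → ℝ satisfy 0 ≤ q i ≤ 1 for all i. Then there exists a finitely supported probability distribution μ on the set of patterns a : Fin n → Bool such that: (i) for every nonempty subset S ⊆ Fin n, the probability μ({a | ∀ i ∈ S, a i = false}) equals min_{i ∈ S} q i; in particular, for every i, μ({a | a i = false}) = q i; and (ii) the support of μ contains at most n + 1 patterns. -/
open MeasureTheory

/-- The pattern in which coordinate `i` is blank exactly when the level `u` is below `q i`. -/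
noncomputable def thresholdPattern {ι : Type*} (q : ι → ℝ) (u : ℝ) : ι → Bool :=
  fun i => decide (q i ≤ u)

theorem thresholdPattern_eq_false {ι : Type*} {q : ι → ℝ} {u : ℝ} {i : ι} :
    thresholdPattern q u i = false ↔ u < q i := by
  simp [thresholdPattern]

theorem measurable_thresholdPattern {ι : Type*} (q : ι → ℝ) :
    Measurable (thresholdPattern q) := by
  refine measurable_pi_lambda _ fun i => measurable_to_bool ?_
  have : (fun u => thresholdPattern q u i) ⁻¹' {true} = Set.Ici (q i) := by
    ext u
    simp [thresholdPattern]
  rw [this]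
  exact measurableSet_Ici

/-- At most `card ι + 1` patterns arise as the level varies: every pattern is either all blank
or the pattern at one of the thresholds. -/
theorem exists_option_thresholdPattern_eq {ι : Type*} [Fintype ι] (q : ι → ℝ) (u : ℝ) :
    ∃ o : Option ι, o.elim (fun _ => false) (fun i => thresholdPattern q (q i)) =
      thresholdPattern q u := by
  classical
  by_cases h : (Finset.univ.filter fun i => q i ≤ u).Nonempty
  · obtain ⟨i, hi, hmax⟩ := Finset.exists_max_image _ q h
    simp only [Finset.mem_filter, Finset.mem_univ, true_and] at hi hmax
    refine ⟨some i, funext fun j => ?_⟩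
    simp only [Option.elim_some, thresholdPattern, decide_eq_decide]
    exact ⟨fun hj => hj.trans hi, hmax j⟩
  · refine ⟨none, funext fun j => ?_⟩
    simp only [Finset.not_nonempty_iff_eq_empty, Finset.filter_eq_empty_iff, Finset.mem_univ,
      true_imp_iff] at h
    simp [thresholdPattern, h]

/-- The law of the threshold pattern at a uniform level in `[0, 1)`. -/
noncomputable def thresholdLaw {ι : Type*} (q : ι → ℝ) : Measure (ι → Bool) :=
  (volume.restrict (Set.Ico (0 : ℝ) 1)).map (thresholdPattern q)

instance {ι : Type*} (q : ι → ℝ) : IsProbabilityMeasure (thresholdLaw q) := by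
  have : IsProbabilityMeasure (volume.restrict (Set.Ico (0 : ℝ) 1)) := ⟨by simp⟩
  exact Measure.isProbabilityMeasure_map (measurable_thresholdPattern q).aemeasurable

theorem thresholdLaw_real_forall_eq_false {ι : Type*} [Finite ι] {q : ι → ℝ}
    (hq : ∀ i, 0 ≤ q i ∧ q i ≤ 1) (S : Finset ι) (hS : S.Nonempty) :
    (thresholdLaw q).real {a | ∀ i ∈ S, a i = false} = S.inf' hS q := by
  have hpre : thresholdPattern q ⁻¹' {a | ∀ i ∈ S, a i = false} ∩ Set.Ico 0 1 =
      Set.Ico 0 (S.inf' hS q) := by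
    ext u
    obtain ⟨i, hi⟩ := id hS
    simp only [Set.mem_inter_iff, Set.mem_preimage, Set.mem_ofPred_eq, thresholdPattern_eq_false,
      Set.mem_Ico, Finset.lt_inf'_iff hS]
    exact ⟨fun h => ⟨h.2.1, h.1⟩, fun h => ⟨h.2, h.1, (h.2 i hi).trans_le (hq i).2⟩⟩
  have hmeas : MeasurableSet {a : ι → Bool | ∀ i ∈ S, a i = false} :=
    (Set.toFinite _).measurableSet
  rw [thresholdLaw, map_measureReal_apply (measurable_thresholdPattern q) hmeas,
    measureReal_restrict_apply (measurable_thresholdPattern q hmeas), hpre,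
    Real.volume_real_Ico_of_le (Finset.le_inf' _ _ fun i _ => (hq i).1), sub_zero]

theorem exists_thresholdPattern_eq_of_thresholdLaw_real_ne_zero {ι : Type*} [Finite ι]
    {q : ι → ℝ} {a : ι → Bool} (ha : (thresholdLaw q).real {a} ≠ 0) :
    ∃ u, thresholdPattern q u = a := by
  contrapose! ha
  have hpre : thresholdPattern q ⁻¹' {a} = ∅ := Set.eq_empty_of_forall_notMem ha
  rw [thresholdLaw, map_measureReal_apply (measurable_thresholdPattern q)
    (measurableSet_singleton a), hpre, measureReal_empty]

/-- Achievability part of the synchronous ABRB structure theorem: for any marginals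
`q i ∈ [0,1]` there is a finitely supported probability distribution on patterns
`Fin n → Bool` whose joint-blank probability on every nonempty subset `S` equals
`min_{i ∈ S} q i` (in particular the marginals are `q`), supported on at most
`n + 1` patterns. -/
theorem stmt_0 (n : ℕ) (hn : 1 ≤ n) (q : Fin n → ℝ)
    (hq : ∀ i, 0 ≤ q i ∧ q i ≤ 1) :
    ∃ μ : (Fin n → Bool) → ℝ,
      (∀ a, 0 ≤ μ a) ∧
      (∑ a, μ a = 1) ∧
      (∀ S : Finset (Fin n), ∀ hS : S.Nonempty,
        ∑ a ∈ Finset.univ.filter (fun a : Fin n → Bool => ∀ i ∈ S, a i = false), μ a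
          = S.inf' hS q) ∧
      (∀ i : Fin n,
        ∑ a ∈ Finset.univ.filter (fun a : Fin n → Bool => a i = false), μ a = q i) ∧
      (Finset.univ.filter (fun a : Fin n → Bool => μ a ≠ 0)).card ≤ n + 1 := by
  classical
  have hS (S : Finset (Fin n)) (hS : S.Nonempty) :
      ∑ a ∈ Finset.univ.filter (fun a : Fin n → Bool => ∀ i ∈ S, a i = false),
        (thresholdLaw q).real {a} = S.inf' hS q := by
    rw [sum_measureReal_singleton, ← thresholdLaw_real_forall_eq_false hq S hS]
    simp
  refine ⟨fun a => (thresholdLaw q).real {a}, fun a => measureReal_nonneg, ?_, ?_, ?_, ?_⟩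
  · simp [sum_measureReal_singleton]
  · intro S hne
    convert hS S hne
  · intro i
    simpa using hS {i} (Finset.singleton_nonempty i)
  · calc
      _ ≤ (Finset.univ.image fun o : Option (Fin n) =>
            o.elim (fun _ => false) (fun i => thresholdPattern q (q i))).card := by
        refine Finset.card_le_card fun a ha => ?_
        obtain ⟨u, rfl⟩ := exists_thresholdPattern_eq_of_thresholdLaw_real_ne_zero
          (Finset.mem_filter.1 ha).2
        simpa only [Finset.mem_image, Finset.mem_univ, true_and] using
          exists_option_thresholdPattern_eq q u
      _ ≤ n + 1 := Finset.card_image_le.trans (by simp)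
end

section
/- Let n ≥ 1 and let μ be a probability distribution on patterns a : Fin n → Bool. Set q i := μ({a | a i = false}). Suppose that for every nonempty subset S ⊆ Fin n, μ({a | ∀ i ∈ S, a i = false}) = min_{i ∈ S} q i. Then the support of μ is a chain under the coordinatewise order on Fin n → Bool: any two patterns a, b in the support of μ satisfy a ≤ b or b ≤ a (where a ≤ b means a i = true implies b i = true for all i). -/
/-- If blanking all of `S` is as likely as blanking `k ∈ S` alone, then every pattern of positive
weight that blanks `k` blanks all of `S`. -/
theorem forall_eq_false_of_sum_eq {ι : Type*} [Fintype ι] [DecidableEq ι]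
    {μ : (ι → Bool) → ℝ} (hμ0 : ∀ a, 0 ≤ μ a) {S : Finset ι} {k : ι} (hk : k ∈ S)
    (h : ∑ a ∈ Finset.univ.filter (fun a : ι → Bool => ∀ i ∈ S, a i = false), μ a
      = ∑ a ∈ Finset.univ.filter (fun a : ι → Bool => a k = false), μ a)
    {c : ι → Bool} (hc : μ c ≠ 0) (hck : c k = false) : ∀ i ∈ S, c i = false := by
  by_contra hcS
  refine h.not_lt (Finset.sum_lt_sum_of_subset (i := c) ?_ ?_ ?_ ((hμ0 c).lt_of_ne' hc)
    fun a _ _ => hμ0 a)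
  · exact Finset.monotone_filter_right _ fun a _ ha => ha k hk
  · simpa using hck
  · simpa using hcS

/-- Structural ("only if") part of the synchronous ABRB theorem: a distribution whose
joint-blank probability on every nonempty subset `S` equals the minimum of its
marginals must have a support that is a chain in the coordinatewise order. -/
theorem stmt_2 (n : ℕ) (hn : 1 ≤ n) (μ : (Fin n → Bool) → ℝ)
    (hμ0 : ∀ a, 0 ≤ μ a) (hμ1 : ∑ a, μ a = 1)
    (q : Fin n → ℝ)
    (hq : ∀ i, q i = ∑ a ∈ Finset.univ.filter (fun a : Fin n → Bool => a i = false), μ a)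
    (hsync : ∀ S : Finset (Fin n), ∀ hS : S.Nonempty,
      ∑ a ∈ Finset.univ.filter (fun a : Fin n → Bool => ∀ i ∈ S, a i = false), μ a
        = S.inf' hS q) :
    ∀ a b : Fin n → Bool, μ a ≠ 0 → μ b ≠ 0 →
      (∀ i, a i = true → b i = true) ∨ (∀ i, b i = true → a i = true) := by
  intro a b ha hb
  by_contra! hab
  obtain ⟨⟨i, hai, hbi⟩, j, hbj, haj⟩ := hab
  have hS : ({i, j} : Finset (Fin n)).Nonempty := Finset.insert_nonempty _ _
  obtain ⟨k, hk, hkq⟩ := Finset.exists_mem_eq_inf' hS q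
  have key := (hsync _ hS).trans (hkq.trans (hq k))
  have blank {c : Fin n → Bool} (hc : μ c ≠ 0) (hck : c k = false) :=
    forall_eq_false_of_sum_eq hμ0 hk (by convert key) hc hck
  rcases (by simpa using hk : k = i ∨ k = j) with rfl | rfl
  · simpa [hbj] using blank hb (by simpa using hbi) j (by simp)
  · simpa [hai] using blank ha (by simpa using haj) i (by simp)
end

section
/- Let n ≥ 1 and let q : Fin n → ℝ be monotone nondecreasing with 0 ≤ q i ≤ 1 for all i. For j ∈ {0, 1, …, n} define weights p j by: p 0 = q 0, p j = q j − q (j−1) for 1 ≤ j ≤ n − 1, and p n = 1 − q (n−1); and define patterns b j : Fin n → Bool by b j i = true if and only if i < j. Then: (i) p j ≥ 0 for all j and Σ_{j=0}^{n} p j = 1; (ii) for every i ∈ Fin n, Σ_{j : (b j) i = false} p j = q i; and (iii) for every nonempty S ⊆ Fin n, Σ_{j : ∀ i ∈ S, (b j) i = false} p j = min_{i ∈ S} q i. -/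
/-- Telescoping sum over an initial segment of `Fin m`. -/
theorem sum_fin_filter_le_telescope {m : ℕ} (f : ℕ → ℝ) (k : ℕ) (hk : k < m) :
    ∑ j ∈ Finset.univ.filter (fun j : Fin m => (j : ℕ) ≤ k),
      (f (j + 1) - f j) = f (k + 1) - f 0 := by
  rw [← Finset.sum_range_sub f (k + 1)]
  refine Finset.sum_bij (fun j _ => (j : ℕ)) ?_ ?_ ?_ ?_
  · intro j hj
    simp only [Finset.mem_filter, Finset.mem_univ, true_and] at hj
    exact Finset.mem_range.2 (by omega)
  · intro a _ c _ h
    exact Fin.ext h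
  · intro j hj
    have hj' := Finset.mem_range.1 hj
    refine ⟨⟨j, by omega⟩, ?_, rfl⟩
    simp only [Finset.mem_filter, Finset.mem_univ, true_and]
    omega
  · intro j _
    rfl


/-- The explicit synchronous ABRB construction: for nondecreasing marginals `q`,
the nested patterns `b j` (with `b j i = true` iff `i < j`) weighted by the
consecutive differences `p j` of the sorted marginals form a probability
distribution with marginals `q` that achieves joint-blank probability
`min_{i ∈ S} q i` on every nonempty subset `S`. -/
theorem stmt_3 (n : ℕ) (hn : 1 ≤ n) (q : Fin n → ℝ)
    (hmono : Monotone q) (hq : ∀ i, 0 ≤ q i ∧ q i ≤ 1)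
    (p : Fin (n + 1) → ℝ)
    (hp0 : p 0 = q ⟨0, hn⟩)
    (hpmid : ∀ j : ℕ, ∀ (hj1 : 1 ≤ j), ∀ (hj2 : j ≤ n - 1),
      p ⟨j, by omega⟩ = q ⟨j, by omega⟩ - q ⟨j - 1, by omega⟩)
    (hpn : p ⟨n, by omega⟩ = 1 - q ⟨n - 1, by omega⟩)
    (b : Fin (n + 1) → Fin n → Bool)
    (hb : ∀ j i, b j i = decide ((i : ℕ) < (j : ℕ))) :
    ((∀ j, 0 ≤ p j) ∧ ∑ j, p j = 1) ∧
    (∀ i : Fin n,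
      ∑ j ∈ Finset.univ.filter (fun j => b j i = false), p j = q i) ∧
    (∀ S : Finset (Fin n), ∀ hS : S.Nonempty,
      ∑ j ∈ Finset.univ.filter (fun j => ∀ i ∈ S, b j i = false), p j = S.inf' hS q) := by
  obtain ⟨f, hf0, hfq, hfn⟩ : ∃ f : ℕ → ℝ, f 0 = 0 ∧ (∀ i : Fin n, f (i + 1) = q i) ∧
      f (n + 1) = 1 :=
    ⟨fun k => if k = 0 then 0 else if h : k - 1 < n then q ⟨k - 1, h⟩ else 1,
      by simp, fun i => by simp, by simp⟩
  have hpf : ∀ j : Fin (n + 1), p j = f (j + 1) - f j := by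
    rintro ⟨j, hj⟩
    rcases Nat.eq_zero_or_pos j with rfl | hj0
    · have h := hfq ⟨0, hn⟩
      simp only at h ⊢
      rw [h, hf0, sub_zero]
      exact hp0
    · have hprev := hfq ⟨j - 1, by omega⟩
      simp only [Nat.sub_add_cancel hj0] at hprev
      rcases Nat.lt_or_ge j n with hjn | hjn
      · have h := hfq ⟨j, hjn⟩
        simp only at h ⊢
        rw [h, hprev]
        exact hpmid j hj0 (by omega)
      · obtain rfl : j = n := by omega
        simp only
        rw [hfn, hprev]
        exact hpn
  have hsum : ∀ k : ℕ, k < n + 1 →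
      ∑ j ∈ Finset.univ.filter (fun j : Fin (n + 1) => (j : ℕ) ≤ k), p j = f (k + 1) := by
    intro k hk
    rw [Finset.sum_congr rfl fun j _ => hpf j, sum_fin_filter_le_telescope f k hk, hf0, sub_zero]
  have hmarg : ∀ i : Fin n,
      ∑ j ∈ Finset.univ.filter (fun j => b j i = false), p j = q i := by
    intro i
    rw [← hfq i, ← hsum i (by omega)]
    simp [hb]
  refine ⟨⟨?_, ?_⟩, hmarg, ?_⟩
  · rintro ⟨j, hj⟩
    rcases Nat.eq_zero_or_pos j with rfl | hj0
    · exact hp0 ▸ (hq _).1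
    · rcases Nat.lt_or_ge j n with hjn | hjn
      · rw [hpmid j hj0 (by omega)]
        exact sub_nonneg.2 (hmono (Fin.mk_le_mk.2 (Nat.sub_le j 1)))
      · obtain rfl : j = n := by omega
        rw [hpn]
        exact sub_nonneg.2 (hq _).2
  · rw [← hfn, ← hsum n (Nat.lt_succ_self n), Finset.filter_true_of_mem]
    intro j _
    omega
  · intro S hS
    have hmin : S.inf' hS q = q (S.min' hS) :=
      le_antisymm (Finset.inf'_le q (S.min'_mem hS))
        (Finset.le_inf' hS q fun i hi => hmono (S.min'_le i hi))
    rw [hmin, ← hmarg]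
    congr 1
    ext j
    simp only [Finset.mem_filter, Finset.mem_univ, true_and, hb, decide_eq_false_iff_not, not_lt]
    exact ⟨fun h => h _ (S.min'_mem hS), fun h i hi => h.trans (S.min'_le i hi)⟩
end

section
/- Let N ≥ 1 and let K be a finite index set partitioned into three subsets U_MN, U_PN, U_PI. For each k ∈ K let w k ≥ 0 and let e k ≥ ē k ≥ 0 be real constants; for each k ∈ U_MN let b k ∈ Fin N; for each k ∈ U_PN ∪ U_PI let B k be a nonempty subset of Fin N. Let u : ℝ → ℝ be concave and monotone nondecreasing. Then the function Û : (Fin N → ℝ) → ℝ defined by Û(q) = Σ_{k ∈ U_MN} w k · u((1 − q (b k)) · e k) + Σ_{k ∈ U_PN} w k · u(ē k + (e k − ē k) · min_{j ∈ B k} q j) + Σ_{k ∈ U_PI} w k · u(e k · min_{j ∈ B k} q j) is concave on Fin N → ℝ (and in particular on the box [0,1]^N). -/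
/-- The minimum of the coordinates over a nonempty finite index set is concave. -/
theorem concaveOn_sInf_image {ι : Type*} {B : Finset ι} (hB : B.Nonempty) :
    ConcaveOn ℝ Set.univ (fun q : ι → ℝ => sInf (q '' (B : Set ι))) := by
  refine ⟨convex_univ, fun x _ y _ a c ha hc _ => ?_⟩
  have hle (q : ι → ℝ) {j : ι} (hj : j ∈ B) : sInf (q '' (B : Set ι)) ≤ q j :=
    csInf_le (B.finite_toSet.image q).bddBelow (Set.mem_image_of_mem q hj)
  refine le_csInf (Set.Nonempty.image _ hB) ?_
  rintro _ ⟨j, hj, rfl⟩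
  exact add_le_add (mul_le_mul_of_nonneg_left (hle x hj) ha)
    (mul_le_mul_of_nonneg_left (hle y hj) hc)

/-- A finite sum of nonnegative multiples of concave functions is concave. -/
theorem concaveOn_sum_mul {E ι : Type*} [AddCommMonoid E] [Module ℝ E] {S : Set E}
    (hS : Convex ℝ S) (s : Finset ι) {w : ι → ℝ} {f : ι → E → ℝ}
    (hw : ∀ i ∈ s, 0 ≤ w i) (hf : ∀ i ∈ s, ConcaveOn ℝ S (f i)) :
    ConcaveOn ℝ S (fun x => ∑ i ∈ s, w i * f i x) := by
  refine ⟨hS, fun x hx y hy a c ha hc hac => ?_⟩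
  simp only [smul_eq_mul, Finset.mul_sum, ← Finset.sum_add_distrib]
  refine Finset.sum_le_sum fun i hi => ?_
  have h := mul_le_mul_of_nonneg_left ((hf i hi).2 hx hy ha hc hac) (hw i hi)
  simp only [smul_eq_mul] at h
  linarith

/-- A concave nondecreasing function of a concave function is concave. -/
theorem ConcaveOn.comp_monotone {E : Type*} [AddCommMonoid E] [Module ℝ E] {S : Set E}
    {u : ℝ → ℝ} {f : E → ℝ} (hu : ConcaveOn ℝ Set.univ u) (hmono : Monotone u)
    (hf : ConcaveOn ℝ S f) : ConcaveOn ℝ S (fun x => u (f x)) :=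
  ⟨hf.1, fun _ hx _ hy _ _ ha hc hac =>
    (hu.2 trivial trivial ha hc hac).trans (hmono (hf.2 hx hy ha hc hac))⟩

/-- Corollary 1 (convexity in the ABRB marginals): the utility
`Û(q) = Σ_{k ∈ U_MN} w k u((1 - q (b k)) e k)
      + Σ_{k ∈ U_PN} w k u(ē k + (e k - ē k) min_{j ∈ B k} q j)
      + Σ_{k ∈ U_PI} w k u(e k min_{j ∈ B k} q j)`
is concave in `q` for any concave nondecreasing `u`, nonnegative weights and
constants `e k ≥ ē k ≥ 0`.  (The minimum over the nonempty neighbor set `B k`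
is expressed as `sInf (q '' B k)`.) -/
theorem stmt_5 (N : ℕ) (hN : 1 ≤ N) (K : Type) [Fintype K] [DecidableEq K]
    (UMN UPN UPI : Finset K)
    (hd1 : Disjoint UMN UPN) (hd2 : Disjoint UMN UPI) (hd3 : Disjoint UPN UPI)
    (hcover : UMN ∪ UPN ∪ UPI = Finset.univ)
    (w : K → ℝ) (hw : ∀ k, 0 ≤ w k)
    (e ebar : K → ℝ) (hee : ∀ k, ebar k ≤ e k) (hebar : ∀ k, 0 ≤ ebar k)
    (b : K → Fin N)
    (B : K → Finset (Fin N)) (hB : ∀ k ∈ UPN ∪ UPI, (B k).Nonempty)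
    (u : ℝ → ℝ) (hu : ConcaveOn ℝ Set.univ u) (humono : Monotone u) :
    ConcaveOn ℝ Set.univ (fun q : Fin N → ℝ =>
      (∑ k ∈ UMN, w k * u ((1 - q (b k)) * e k)) +
      (∑ k ∈ UPN, w k * u (ebar k + (e k - ebar k) * sInf (q '' (B k : Set (Fin N))))) +
      (∑ k ∈ UPI, w k * u (e k * sInf (q '' (B k : Set (Fin N)))))) := by
  refine ((concaveOn_sum_mul convex_univ UMN (fun k _ => hw k) fun k _ => ?_).add
    (concaveOn_sum_mul convex_univ UPN (fun k _ => hw k) fun k hk => ?_)).add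
    (concaveOn_sum_mul convex_univ UPI (fun k _ => hw k) fun k hk => ?_)
  · refine hu.comp_monotone humono ⟨convex_univ, fun x _ y _ a c _ _ hac => le_of_eq ?_⟩
    simp only [smul_eq_mul, Pi.add_apply, Pi.smul_apply]
    linear_combination e k * hac
  · have h := concaveOn_sInf_image (hB k (Finset.mem_union_left _ hk))
    exact hu.comp_monotone humono
      ((concaveOn_const (ebar k) convex_univ).add (h.smul (sub_nonneg.2 (hee k))))
  · have h := concaveOn_sInf_image (hB k (Finset.mem_union_right _ hk))
    exact hu.comp_monotone humono (h.smul ((hebar k).trans (hee k)))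
end

section
/- Let d ≥ 1 and let V be a finite subset of EuclideanSpace ℝ (Fin d). If x lies in the frontier (topological boundary) of the convex hull of V, then there exists a subset T ⊆ V with card T ≤ d such that x lies in the convex hull of T. -/
/-- A positive convex combination of an affine basis lies in the interior of its convex hull. -/
theorem AffineBasis.sum_smul_mem_interior_convexHull {ι E : Type*} [Fintype ι]
    [NormedAddCommGroup E] [NormedSpace ℝ E] (b : AffineBasis ι ℝ E) {w : ι → ℝ}
    (hw : ∀ i, 0 < w i) (hw₁ : ∑ i, w i = 1) :
    ∑ i, w i • b i ∈ interior (convexHull ℝ (Set.range b)) := by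
  rw [b.interior_convexHull]
  intro i
  rw [← Finset.affineCombination_eq_linear_combination _ _ _ hw₁,
    b.coord_apply_combination_of_mem (Finset.mem_univ i) hw₁]
  exact hw i

/-- **Carathéodory's theorem for boundary points**: a point of a convex hull outside its interior
lies in the convex hull of at most `finrank ℝ E` of the generating points. -/
theorem exists_finset_card_le_finrank_of_notMem_interior_convexHull {E : Type*}
    [NormedAddCommGroup E] [NormedSpace ℝ E] [FiniteDimensional ℝ E] {s : Set E} {x : E}
    (hx : x ∈ convexHull ℝ s) (hxi : x ∉ interior (convexHull ℝ s)) :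
    ∃ t : Finset E, ↑t ⊆ s ∧ t.card ≤ Module.finrank ℝ E ∧ x ∈ convexHull ℝ (t : Set E) := by
  classical
  obtain ⟨ι, _, z, w, hzs, hz, hw, hw₁, rfl⟩ := eq_pos_convex_span_of_mem_convexHull hx
  refine ⟨Finset.univ.image z, by simpa using hzs, ?_, ?_⟩
  · refine Finset.card_image_le.trans ?_
    rw [Finset.card_univ]
    by_contra! hcard
    have hcard' : Fintype.card ι = Module.finrank ℝ E + 1 :=
      le_antisymm (hz.card_le_finrank_succ.trans
        (Nat.succ_le_succ (Submodule.finrank_le _))) hcard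
    let b : AffineBasis ι ℝ E := ⟨z, hz, hz.affineSpan_eq_top_iff_card_eq_finrank_add_one.2 hcard'⟩
    exact hxi (interior_mono (convexHull_mono hzs) (b.sum_smul_mem_interior_convexHull hw hw₁))
  · exact (convex_convexHull ℝ _).sum_mem (fun i _ ↦ (hw i).le) hw₁
      fun i _ ↦ subset_convexHull ℝ _ (by simp)

/-- Carathéodory-type fact for boundary points: a point of the frontier of the convex
hull of a finite set `V` in `d`-dimensional Euclidean space lies in the convex hull
of at most `d` points of `V`. -/
theorem stmt_11 (d : ℕ) (hd : 1 ≤ d) (V : Finset (EuclideanSpace ℝ (Fin d)))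
    (x : EuclideanSpace ℝ (Fin d))
    (hx : x ∈ frontier (convexHull ℝ (V : Set (EuclideanSpace ℝ (Fin d))))) :
    ∃ T : Finset (EuclideanSpace ℝ (Fin d)), T ⊆ V ∧ T.card ≤ d ∧
      x ∈ convexHull ℝ (T : Set (EuclideanSpace ℝ (Fin d))) := by
  have hx' : x ∈ convexHull ℝ (V : Set (EuclideanSpace ℝ (Fin d))) :=
    (V.finite_toSet.isClosed_convexHull ℝ).frontier_subset hx
  obtain ⟨T, hTV, hcard, hxT⟩ :=
    exists_finset_card_le_finrank_of_notMem_interior_convexHull hx' hx.2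
  exact ⟨T, Finset.coe_subset.1 hTV, by simpa using hcard, hxT⟩
end
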